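/- arXiv:2410.15196 — 2 statements merged into one kernel-verified Lean document; each statement's English description precedes it below -/
import Mathlib

section
/- Let E₀ > 0 and let δ = δ(E₀) > 0 be the constant from the local boundary-injectivity lemma. Let η₀ ∈ int(𝓔) satisfy Ẽ_el(η₀) ≤ E₀ and be injective on ∂Ω₀, and set ε := min{|η₀(X₁) − η₀(X₂)| : X₁, X₂ ∈ ∂Ω₀, |X₁ − X₂| ≥ δ} > 0. Then there exists a constant Γ = Γ(η₀, E₀) > 0 such that every deformation η ∈ 𝓔 with Ẽ_el(η) ≤ E₀ and ‖η − η₀‖_{L²(Ω₀)} < Γ satisfies |η(X₁) − η(X₂)| ≥ ε/2 for all X₁, X₂ ∈ ∂Ω₀ with |X₁ − X₂| ≥ δ. -/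
open MeasureTheory Filter Set
open scoped Topology ENNReal

noncomputable section

attribute [local instance] Matrix.normedAddCommGroup Matrix.normedSpace


/-- Points of physical space `ℝ³`. -/
abbrev ℝ3 : Type := Fin 3 → ℝ

/-- `3 × 3` real matrices. -/
abbrev Mat3 : Type := Matrix (Fin 3) (Fin 3) ℝ

/-- Euclidean inner product on `ℝ³`. -/
def dot3 (v w : ℝ3) : ℝ := ∑ i, v i * w i

/-- Squared Euclidean norm on `ℝ³`. -/
def sq3 (v : ℝ3) : ℝ := ∑ i, (v i) ^ 2

/-- Squared Frobenius norm of a `3 × 3` matrix. -/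
def frob2 (A : Mat3) : ℝ := ∑ i, ∑ j, (A i j) ^ 2

/-- The Jacobian (gradient) matrix `∇η(X)` of a map `η : ℝ³ → ℝ³`. -/
def grad (η : ℝ3 → ℝ3) (X : ℝ3) : Mat3 :=
  Matrix.of fun i j => fderiv ℝ (fun Y => η Y i) X (Pi.single j 1)

/-- The Jacobian determinant `det ∇η(X)`. -/
def Jdet (η : ℝ3 → ℝ3) (X : ℝ3) : ℝ := (grad η X).det

/-- The gradient of a scalar field. -/
def gradS (ψ : ℝ3 → ℝ) (x : ℝ3) : ℝ3 := fun i => fderiv ℝ ψ x (Pi.single i 1)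

/-- Membership in (a smooth representative version of) `H¹(Ω; ℝ³)`. -/
def MemH1 (Ω : Set ℝ3) (M : ℝ3 → ℝ3) : Prop :=
  (∀ x ∈ Ω, DifferentiableAt ℝ M x) ∧
  IntegrableOn (fun x => sq3 (M x) + ‖fderiv ℝ M x‖ ^ 2) Ω

/-- The `H¹(Ω;ℝ³)`-norm. -/
def H1Norm (Ω : Set ℝ3) (M : ℝ3 → ℝ3) : ℝ :=
  Real.sqrt (∫ x in Ω, sq3 (M x) + ‖fderiv ℝ M x‖ ^ 2)

/-- The `L²(Ω;ℝ³)`-norm. -/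
def L2Norm (Ω : Set ℝ3) (M : ℝ3 → ℝ3) : ℝ :=
  Real.sqrt (∫ x in Ω, sq3 (M x))

/-- Membership in the homogeneous Sobolev space `Ḣ¹(ℝ³)` (a smooth-representative proxy:
locally `H¹` functions whose gradient is square integrable on all of `ℝ³`). -/
def MemHdot (ψ : ℝ3 → ℝ) : Prop :=
  Differentiable ℝ ψ ∧ Integrable (fun x => sq3 (gradS ψ x))

/-- `φ` is a weak solution of the magnetostatic Poisson problem
`Δφ = div M` on `ℝ³` for a magnetization `M` supported in `Ω`. -/
def SolvesPoisson (Ω : Set ℝ3) (M : ℝ3 → ℝ3) (φ : ℝ3 → ℝ) : Prop :=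
  MemHdot φ ∧ ∀ ψ : ℝ3 → ℝ, MemHdot ψ →
    ∫ x, dot3 (gradS φ x) (gradS ψ x) = ∫ x in Ω, dot3 (M x) (gradS ψ x)

/-- The setting of the elastic part of the problem: the reference configuration `Ω₀`,
the boundary partition `∂Ω₀ = N ∪ P`, the exponents `q, a`, the elastic energy
density `W` and the boundary deformation `γ` prescribed on `P`. -/
structure ElasticSetting where
  Ω0 : Set ℝ3
  isOpenΩ0 : IsOpen Ω0
  boundedΩ0 : Bornology.IsBounded Ω0
  nonemptyΩ0 : Ω0.Nonempty
  N : Set ℝ3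
  hN : N ⊆ frontier Ω0
  q : ℝ
  a : ℝ
  hq : 3 < q
  ha : 3 * q / (q - 3) < a
  W : Mat3 → ℝ
  hW0 : ∀ θ, 0 ≤ W θ
  γ : ℝ3 → ℝ3
  hγinj : Set.InjOn γ (frontier Ω0 \ N)

namespace ElasticSetting

variable (S : ElasticSetting)

/-- The Dirichlet part `P = ∂Ω₀ \ N` of the boundary. -/
def P : Set ℝ3 := frontier S.Ω0 \ S.N

/-- The integrand of the elastic energy `Ẽ_el`. -/
def eelInt (η : ℝ3 → ℝ3) (X : ℝ3) : ℝ :=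
  S.W (grad η X) + (Jdet η X) ^ (-S.a) + (1 / S.q) * ‖iteratedFDeriv ℝ 2 η X‖ ^ S.q

/-- The elastic energy `Ẽ_el(η)`. -/
def eel (η : ℝ3 → ℝ3) : ℝ := ∫ X in S.Ω0, S.eelInt η X

/-- Membership in (a smooth representative version of) `W^{2,q}(Ω₀;ℝ³)`. -/
def MemW2q (η : ℝ3 → ℝ3) : Prop :=
  ContDiff ℝ 2 η ∧
  IntegrableOn (fun X => ‖η X‖ ^ S.q + ‖fderiv ℝ η X‖ ^ S.q +
    ‖iteratedFDeriv ℝ 2 η X‖ ^ S.q) S.Ω0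

/-- The `W^{2,q}(Ω₀;ℝ³)`-norm. -/
def W2qNorm (η : ℝ3 → ℝ3) : ℝ :=
  (∫ X in S.Ω0, ‖η X‖ ^ S.q + ‖fderiv ℝ η X‖ ^ S.q +
    ‖iteratedFDeriv ℝ 2 η X‖ ^ S.q) ^ (1 / S.q)

/-- The `W^{2,q}`-distance of two deformations. -/
def W2qDist (η₁ η₂ : ℝ3 → ℝ3) : ℝ :=
  (∫ X in S.Ω0, ‖η₁ X - η₂ X‖ ^ S.q + ‖fderiv ℝ η₁ X - fderiv ℝ η₂ X‖ ^ S.q +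
    ‖iteratedFDeriv ℝ 2 η₁ X - iteratedFDeriv ℝ 2 η₂ X‖ ^ S.q) ^ (1 / S.q)

/-- The `C¹(Ω̄₀)`-distance of two deformations. -/
def C1dist (η₁ η₂ : ℝ3 → ℝ3) : ℝ :=
  sSup ((fun X => ‖η₁ X - η₂ X‖ + ‖fderiv ℝ η₁ X - fderiv ℝ η₂ X‖) '' closure S.Ω0)

/-- The `W^{1,∞}(Ω₀)`-norm of a deformation. -/
def W1infNorm (η : ℝ3 → ℝ3) : ℝ :=
  sSup ((fun X => ‖η X‖ + ‖fderiv ℝ η X‖) '' closure S.Ω0)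

/-- The Ciarlet–Nečas non-interpenetration condition `|η(Ω₀)| = ∫_{Ω₀} det ∇η dX`. -/
def CiarletNecas (η : ℝ3 → ℝ3) : Prop :=
  volume (η '' S.Ω0) = ENNReal.ofReal (∫ X in S.Ω0, Jdet η X)

/-- The affine space `{η ∈ W^{2,q}(Ω₀;ℝ³) : η|_P = γ}`. -/
def AffSpace (η : ℝ3 → ℝ3) : Prop :=
  S.MemW2q η ∧ Set.EqOn η S.γ S.P

/-- The admissible set `𝓔` of deformations:  `W^{2,q}`-deformations with finite elastic
energy (in particular `det ∇η > 0` a.e.), satisfying the Ciarlet–Nečas condition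
and the boundary condition `η|_P = γ`. -/
def memE (η : ℝ3 → ℝ3) : Prop :=
  S.MemW2q η ∧
  (∀ᵐ X ∂(volume.restrict S.Ω0), 0 < Jdet η X) ∧
  IntegrableOn (S.eelInt η) S.Ω0 ∧
  S.CiarletNecas η ∧
  Set.EqOn η S.γ S.P

/-- Membership in the interior `int 𝓔` of the admissible set, relative to the affine
space `{η ∈ W^{2,q} : η|_P = γ}`. -/
def memIntE (η : ℝ3 → ℝ3) : Prop :=
  S.memE η ∧ ∃ ε > 0, ∀ η', S.AffSpace η' → S.W2qDist η η' < ε → S.memE η'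

open Classical in
/-- The Eulerian magnetization `M_η[M̃] = (det ∇η)⁻¹ M̃ ∘ η⁻¹`, extended by zero
outside the current configuration `η(Ω₀)`. -/
def eulM (η Mt : ℝ3 → ℝ3) (x : ℝ3) : ℝ3 :=
  if x ∈ η '' S.Ω0 then
    (Jdet η (Function.invFunOn η S.Ω0 x))⁻¹ • Mt (Function.invFunOn η S.Ω0 x)
  else 0

end ElasticSetting

/-!
STATEMENT 14: quantitative boundary injectivity at distance `≥ δ` is stable under
`L²`-small perturbations with bounded elastic energy: with `ε` the minimal
separation `|η₀(X₁) − η₀(X₂)|` of `δ`-separated boundary points of `η₀`, there is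
`Γ = Γ(η₀, E₀) > 0` such that every `η ∈ 𝓔` with `Ẽ_el(η) ≤ E₀` and
`‖η − η₀‖_{L²(Ω₀)} < Γ` satisfies `|η(X₁) − η(X₂)| ≥ ε/2` for all such pairs.
-/

/-- A continuous function is integrable on a bounded subset of `ℝ³`. -/
lemma Continuous.integrableOn_of_isBounded {F : Type*} [NormedAddCommGroup F] {Ω : Set ℝ3}
    (hb : Bornology.IsBounded Ω) {f : ℝ3 → F} (hf : Continuous f) : IntegrableOn f Ω :=
  (hf.continuousOn.integrableOn_compact hb.isCompact_closure).mono_set subset_closure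

lemma norm_fderiv_fderiv_eq (u : ℝ3 → ℝ) (x : ℝ3) :
    ‖fderiv ℝ (fderiv ℝ u) x‖ = ‖iteratedFDeriv ℝ 2 u x‖ := by
  rw [← norm_iteratedFDeriv_fderiv, norm_iteratedFDeriv_one]

/-- A directional derivative is controlled by the values at the ends of a segment and the
integral of the second derivative along it. -/
lemma abs_fderiv_apply_le_of_segment {u : ℝ3 → ℝ} (hu : ContDiff ℝ 2 u) {e : ℝ3} (he : ‖e‖ ≤ 1)
    {h : ℝ} (hh : 0 < h) (x : ℝ3) :
    |fderiv ℝ u x e| ≤ (|u (x + h • e)| + |u x|) / h +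
      ∫ s in (0 : ℝ)..h, ‖iteratedFDeriv ℝ 2 u (x + s • e)‖ := by
  have hline : ∀ s : ℝ, HasDerivAt (fun s : ℝ => x + s • e) e s := fun s => by
    simpa using ((hasDerivAt_id s).smul_const e).const_add x
  have hd1 : ∀ s : ℝ, HasDerivAt (fun s : ℝ => u (x + s • e)) (fderiv ℝ u (x + s • e) e) s :=
    fun s => ((hu.differentiable (by norm_num)) _).hasFDerivAt.comp_hasDerivAt s (hline s)
  have hu' : ContDiff ℝ 1 (fderiv ℝ u) := hu.fderiv_right (by norm_num)
  have hd2 : ∀ s : ℝ, HasDerivAt (fun s : ℝ => fderiv ℝ u (x + s • e) e)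
      (fderiv ℝ (fderiv ℝ u) (x + s • e) e e) s := fun s => by
    have := ((hu'.differentiable (by norm_num)) (x + s • e)).hasFDerivAt.comp_hasDerivAt s (hline s)
    simpa using this.clm_apply (hasDerivAt_const s e)
  have hc2 : Continuous fun s : ℝ => fderiv ℝ (fderiv ℝ u) (x + s • e) e e := by
    have : Continuous (fderiv ℝ (fderiv ℝ u)) := hu'.continuous_fderiv (by norm_num)
    fun_prop
  have hc3 : Continuous fun s : ℝ => ‖iteratedFDeriv ℝ 2 u (x + s • e)‖ := by
    have : Continuous (iteratedFDeriv ℝ 2 u) := hu.continuous_iteratedFDeriv le_rfl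
    fun_prop
  obtain ⟨s, hs, hsd⟩ := exists_hasDerivAt_eq_slope (fun s : ℝ => u (x + s • e)) _ hh
    (fun t _ => (hd1 t).continuousAt.continuousWithinAt) (fun t _ => hd1 t)
  have hftc : ∫ t in (0 : ℝ)..s, fderiv ℝ (fderiv ℝ u) (x + t • e) e e =
      fderiv ℝ u (x + s • e) e - fderiv ℝ u x e := by
    simpa using intervalIntegral.integral_eq_sub_of_hasDerivAt (fun t _ => hd2 t)
      (hc2.intervalIntegrable (μ := volume) 0 s)
  have hle : |∫ t in (0 : ℝ)..s, fderiv ℝ (fderiv ℝ u) (x + t • e) e e| ≤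
      ∫ t in (0 : ℝ)..h, ‖iteratedFDeriv ℝ 2 u (x + t • e)‖ := by
    calc _ ≤ ∫ t in (0 : ℝ)..s, ‖iteratedFDeriv ℝ 2 u (x + t • e)‖ := by
          rw [← Real.norm_eq_abs]
          refine intervalIntegral.norm_integral_le_of_norm_le hs.1.le ?_
            (hc3.intervalIntegrable 0 s)
          refine Eventually.of_forall fun t _ => ?_
          rw [← norm_fderiv_fderiv_eq]
          calc _ ≤ ‖fderiv ℝ (fderiv ℝ u) (x + t • e)‖ * ‖e‖ * ‖e‖ :=
                ContinuousLinearMap.le_opNorm₂ _ _ _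
            _ ≤ ‖fderiv ℝ (fderiv ℝ u) (x + t • e)‖ * 1 * 1 := by gcongr
            _ = _ := by ring
      _ ≤ _ := intervalIntegral.integral_mono_interval le_rfl hs.1.le hs.2.le
          (Eventually.of_forall fun t => norm_nonneg _) (hc3.intervalIntegrable 0 h)
  have hslope : |fderiv ℝ u (x + s • e) e| ≤ (|u (x + h • e)| + |u x|) / h := by
    rw [hsd]
    simp only [zero_smul, add_zero, sub_zero, abs_div, abs_of_pos hh]
    gcongr
    exact abs_sub _ _
  have heq : fderiv ℝ u x e = fderiv ℝ u (x + s • e) e -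
      ∫ t in (0 : ℝ)..s, fderiv ℝ (fderiv ℝ u) (x + t • e) e e := by rw [hftc]; ring
  rw [heq]
  exact (abs_sub _ _).trans (add_le_add hslope hle)

lemma setIntegral_comp_add_right_le {Ω K : Set ℝ3} (hK : MeasurableSet K) (hΩ : MeasurableSet Ω)
    (hb : Bornology.IsBounded Ω) {f : ℝ3 → ℝ} (hf : Continuous f) (hf0 : ∀ x, 0 ≤ f x) {v : ℝ3}
    (hv : ∀ x ∈ K, x + v ∈ Ω) : ∫ x in K, f (x + v) ≤ ∫ x in Ω, f x := by
  have hint := hf.integrableOn_of_isBounded hb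
  rw [← integral_indicator hK, ← integral_indicator hΩ,
    ← integral_add_right_eq_self (Ω.indicator f) v]
  refine integral_mono_of_nonneg (Eventually.of_forall fun x => indicator_nonneg
    (fun y _ => hf0 _) x) (((integrable_indicator_iff hΩ).2 hint).comp_add_right v)
    (Eventually.of_forall fun x => ?_)
  by_cases hx : x ∈ K
  · simp [hx, hv x hx]
  · simp only [hx, not_false_eq_true, indicator_of_notMem]
    exact indicator_nonneg (fun y _ => hf0 _) _

/-- Interior interpolation inequality for one directional derivative. -/
lemma setIntegral_abs_fderiv_apply_le {Ω K : Set ℝ3} (hK : IsCompact K) (hΩ : MeasurableSet Ω)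
    (hb : Bornology.IsBounded Ω) {u : ℝ3 → ℝ} (hu : ContDiff ℝ 2 u) {e : ℝ3} (he : ‖e‖ ≤ 1)
    {h : ℝ} (hh : 0 < h) (hKΩ : ∀ x ∈ K, ∀ s ∈ Icc 0 h, x + s • e ∈ Ω) :
    ∫ x in K, |fderiv ℝ u x e| ≤
      2 / h * (∫ x in Ω, |u x|) + h * ∫ x in Ω, ‖iteratedFDeriv ℝ 2 u x‖ := by
  have hc2 : Continuous (iteratedFDeriv ℝ 2 u) := hu.continuous_iteratedFDeriv le_rfl
  have hc1 : Continuous (fderiv ℝ u) := hu.continuous_fderiv (by norm_num)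
  have hc0 : Continuous u := hu.continuous
  have hKb := hK.isBounded
  have hcI : Continuous fun x => ∫ s in (0 : ℝ)..h, ‖iteratedFDeriv ℝ 2 u (x + s • e)‖ := by
    refine intervalIntegral.continuous_parametric_intervalIntegral_of_continuous' ?_ 0 h
    fun_prop
  have i1 : IntegrableOn (fun x => |u (x + h • e)|) K :=
    Continuous.integrableOn_of_isBounded hKb (by fun_prop)
  have i2 : IntegrableOn (fun x => |u x|) K :=
    Continuous.integrableOn_of_isBounded hKb (by fun_prop)
  have i3 := hcI.integrableOn_of_isBounded hKb
  have hswap : ∫ x in K, ∫ s in (0 : ℝ)..h, ‖iteratedFDeriv ℝ 2 u (x + s • e)‖ =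
      ∫ s in (0 : ℝ)..h, ∫ x in K, ‖iteratedFDeriv ℝ 2 u (x + s • e)‖ := by
    symm
    refine intervalIntegral_integral_swap ?_
    rw [Measure.prod_restrict]
    have : Continuous (Function.uncurry fun (s : ℝ) (x : ℝ3) =>
      ‖iteratedFDeriv ℝ 2 u (x + s • e)‖) := by
      unfold Function.uncurry; fun_prop
    exact (this.continuousOn.integrableOn_compact (isCompact_uIcc.prod hK)).mono_set
      (prod_mono uIoc_subset_uIcc subset_rfl)
  have hfub : ∫ x in K, ∫ s in (0 : ℝ)..h, ‖iteratedFDeriv ℝ 2 u (x + s • e)‖ ≤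
      h * ∫ x in Ω, ‖iteratedFDeriv ℝ 2 u x‖ := by
    rw [hswap]
    have hb' : ∀ s ∈ uIoc (0 : ℝ) h, ‖∫ x in K, ‖iteratedFDeriv ℝ 2 u (x + s • e)‖‖ ≤
        ∫ x in Ω, ‖iteratedFDeriv ℝ 2 u x‖ := fun s hs => by
      rw [uIoc_of_le hh.le] at hs
      rw [Real.norm_of_nonneg (integral_nonneg fun _ => norm_nonneg _)]
      exact setIntegral_comp_add_right_le hK.measurableSet hΩ hb
        (f := fun x => ‖iteratedFDeriv ℝ 2 u x‖) (by fun_prop) (fun _ => norm_nonneg _)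
        fun x hx => hKΩ x hx s ⟨hs.1.le, hs.2⟩
    have := intervalIntegral.norm_integral_le_of_norm_le_const hb'
    rw [sub_zero, abs_of_pos hh, mul_comm] at this
    exact (le_abs_self _).trans this
  have t1 : ∫ x in K, |u (x + h • e)| ≤ ∫ x in Ω, |u x| :=
    setIntegral_comp_add_right_le hK.measurableSet hΩ hb (f := fun x => |u x|) (by fun_prop)
      (fun _ => abs_nonneg _) fun x hx => hKΩ x hx h ⟨hh.le, le_rfl⟩
  have t2 : ∫ x in K, |u x| ≤ ∫ x in Ω, |u x| := by
    simpa using setIntegral_comp_add_right_le (v := 0) hK.measurableSet hΩ hb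
      (f := fun x => |u x|) (by fun_prop) (fun _ => abs_nonneg _)
      fun x hx => by simpa using hKΩ x hx 0 ⟨le_rfl, hh.le⟩
  calc ∫ x in K, |fderiv ℝ u x e|
      ≤ ∫ x in K, ((|u (x + h • e)| + |u x|) / h +
          ∫ s in (0 : ℝ)..h, ‖iteratedFDeriv ℝ 2 u (x + s • e)‖) :=
        integral_mono (Continuous.integrableOn_of_isBounded hKb (by fun_prop))
          (((i1.add i2).div_const h).add i3) fun x => abs_fderiv_apply_le_of_segment hu he hh x
    _ = ((∫ x in K, |u (x + h • e)|) + ∫ x in K, |u x|) / h +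
          ∫ x in K, ∫ s in (0 : ℝ)..h, ‖iteratedFDeriv ℝ 2 u (x + s • e)‖ := by
        have i12 : IntegrableOn (fun x => (|u (x + h • e)| + |u x|) / h) K :=
          (i1.add i2).div_const h
        rw [integral_add i12 i3, integral_div, integral_add i1 i2]
    _ ≤ ((∫ x in Ω, |u x|) + ∫ x in Ω, |u x|) / h +
          h * ∫ x in Ω, ‖iteratedFDeriv ℝ 2 u x‖ := by gcongr
    _ = _ := by ring

lemma ContinuousLinearMap.norm_le_sum_abs_apply_single (L : ℝ3 →L[ℝ] ℝ) :
    ‖L‖ ≤ ∑ j, |L (Pi.single j 1)| := by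
  refine L.opNorm_le_bound (Finset.sum_nonneg fun _ _ => abs_nonneg _) fun v => ?_
  have hv : v = ∑ j, v j • (Pi.single j 1 : ℝ3) := by
    ext i; simp [Finset.sum_apply, Pi.single_apply]
  conv_lhs => rw [hv]
  rw [map_sum, Finset.sum_mul]
  refine (norm_sum_le _ _).trans (Finset.sum_le_sum fun j _ => ?_)
  rw [map_smul, smul_eq_mul, norm_mul, mul_comm, Real.norm_eq_abs (L _)]
  gcongr
  exact norm_le_pi_norm v j

lemma norm_single_one_le (j : Fin 3) : ‖(Pi.single j 1 : ℝ3)‖ ≤ 1 := by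
  simp [Pi.norm_single]

/-- On a bounded open set without any boundary regularity, the `W^{1,1}`-norm is controlled by
the `L²`-norm up to a small multiple of the Lipschitz constant and of the second derivatives. -/
lemma exists_const_setIntegral_add_norm_fderiv_le {Ω : Set ℝ3} (hΩ : IsOpen Ω)
    (hb : Bornology.IsBounded Ω) {q : ℝ} (hq : 1 ≤ q) {τ : ℝ} (hτ : 0 < τ) :
    ∃ C, 0 ≤ C ∧ ∀ u : ℝ3 → ℝ, ContDiff ℝ 2 u → ∀ M, 0 ≤ M → (∀ x ∈ Ω, ‖fderiv ℝ u x‖ ≤ M) →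
      ∫ x in Ω, (|u x| + ‖fderiv ℝ u x‖) ≤
        τ * (1 + M + ∫ x in Ω, ‖iteratedFDeriv ℝ 2 u x‖ ^ q) + C * ∫ x in Ω, u x ^ 2 := by
  have hfin : volume Ω ≠ ∞ := hb.measure_lt_top.ne
  obtain ⟨K, hKΩ, hK, hKvol⟩ := hΩ.measurableSet.exists_isCompact_sdiff_lt (μ := volume) hfin
    (ENNReal.ofReal_pos.2 hτ).ne'
  have hdiff : volume.real (Ω \ K) ≤ τ := by
    rw [measureReal_def]
    exact ENNReal.toReal_le_of_le_ofReal hτ.le hKvol.le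
  obtain ⟨h₀, hh₀, hthick⟩ := hK.exists_cthickening_subset_open hΩ hKΩ
  set m := volume.real Ω with hm
  have hm0 : 0 ≤ m := measureReal_nonneg
  set h := min h₀ (τ / (6 * (m + 1))) with hh
  have hhpos : 0 < h := by positivity
  have hhτ : 3 * h * (m + 1) ≤ τ / 2 := by
    have : h ≤ τ / (6 * (m + 1)) := min_le_right _ _
    rw [le_div_iff₀ (by positivity)] at this
    linarith
  set t := τ / (2 * (1 + 6 / h) * (m + 1)) with ht
  have htpos : 0 < t := by positivity
  have htm : (1 + 6 / h) * (t * m) ≤ τ / 2 := by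
    have h1 : (1 + 6 / h) * (t * (m + 1)) = τ / 2 := by rw [ht]; field_simp
    have h2 : (1 + 6 / h) * (t * m) ≤ (1 + 6 / h) * (t * (m + 1)) := by gcongr; linarith
    linarith
  refine ⟨(1 + 6 / h) * (1 / t), by positivity, fun u hu M hM hMu => ?_⟩
  have hc2 : Continuous (iteratedFDeriv ℝ 2 u) := hu.continuous_iteratedFDeriv le_rfl
  have hc1 : Continuous (fderiv ℝ u) := hu.continuous_fderiv (by norm_num)
  have hc0 : Continuous u := hu.continuous
  have hcq : Continuous fun x => ‖iteratedFDeriv ℝ 2 u x‖ ^ q :=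
    hc2.norm.rpow_const fun _ => Or.inr (by linarith)
  have iu : IntegrableOn (fun x => |u x|) Ω :=
    Continuous.integrableOn_of_isBounded hb (by fun_prop)
  have iu2 : IntegrableOn (fun x => u x ^ 2) Ω :=
    Continuous.integrableOn_of_isBounded hb (by fun_prop)
  have ig : IntegrableOn (fun x => ‖fderiv ℝ u x‖) Ω :=
    Continuous.integrableOn_of_isBounded hb (by fun_prop)
  have iH : IntegrableOn (fun x => ‖iteratedFDeriv ℝ 2 u x‖) Ω :=
    Continuous.integrableOn_of_isBounded hb (by fun_prop)
  have iHq := hcq.integrableOn_of_isBounded hb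
  have iconst : ∀ c : ℝ, IntegrableOn (fun _ : ℝ3 => c) Ω := fun c =>
    Continuous.integrableOn_of_isBounded hb continuous_const
  have hcint : ∀ c : ℝ, ∫ _ in Ω, c = m * c := fun c => by simp [hm]
  set H := ∫ x in Ω, ‖iteratedFDeriv ℝ 2 u x‖ ^ q with hH
  set A := ∫ x in Ω, u x ^ 2 with hA
  have hH0 : 0 ≤ H := integral_nonneg fun _ => by positivity
  have hA0 : 0 ≤ A := integral_nonneg fun _ => sq_nonneg _
  have hU : ∫ x in Ω, |u x| ≤ t * m + 1 / t * A := by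
    calc ∫ x in Ω, |u x| ≤ ∫ x in Ω, (t + 1 / t * u x ^ 2) := by
          refine integral_mono iu ((iconst t).add (iu2.const_mul _)) fun x => ?_
          have : 0 ≤ (|u x| - t) ^ 2 + |u x| * t := by positivity
          have h3 : |u x| * t ≤ t ^ 2 + u x ^ 2 := by nlinarith [sq_abs (u x)]
          calc |u x| ≤ (t ^ 2 + u x ^ 2) / t := by rwa [le_div_iff₀ htpos]
            _ = _ := by field_simp
      _ = _ := by
          rw [integral_add (iconst t) (iu2.const_mul _), hcint, integral_const_mul, mul_comm]
  have hHess : ∫ x in Ω, ‖iteratedFDeriv ℝ 2 u x‖ ≤ m + H := by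
    calc ∫ x in Ω, ‖iteratedFDeriv ℝ 2 u x‖
        ≤ ∫ x in Ω, (1 + ‖iteratedFDeriv ℝ 2 u x‖ ^ q) := by
          refine integral_mono iH ((iconst 1).add iHq) fun x => ?_
          rcases le_total ‖iteratedFDeriv ℝ 2 u x‖ 1 with h1 | h1
          · have : 0 ≤ ‖iteratedFDeriv ℝ 2 u x‖ ^ q := by positivity
            dsimp only; linarith
          · have := Real.self_le_rpow_of_one_le h1 hq
            dsimp only; linarith
      _ = _ := by rw [integral_add (iconst 1) iHq, hcint, mul_one]
  have hin : ∫ x in K, ‖fderiv ℝ u x‖ ≤ 3 * (2 / h * (∫ x in Ω, |u x|) + h * (m + H)) := by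
    have idir : ∀ j : Fin 3, IntegrableOn (fun x => |fderiv ℝ u x (Pi.single j 1)|) K :=
      fun j => Continuous.integrableOn_of_isBounded hK.isBounded (by fun_prop)
    calc ∫ x in K, ‖fderiv ℝ u x‖
        ≤ ∫ x in K, ∑ j, |fderiv ℝ u x (Pi.single j 1)| :=
          integral_mono (ig.mono_set hKΩ) (integrable_finsetSum _ fun j _ => idir j)
            fun x => ContinuousLinearMap.norm_le_sum_abs_apply_single _
      _ = ∑ j, ∫ x in K, |fderiv ℝ u x (Pi.single j 1)| :=
          integral_finsetSum _ fun j _ => idir j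
      _ ≤ ∑ _j : Fin 3, (2 / h * (∫ x in Ω, |u x|) + h * (m + H)) := by
          refine Finset.sum_le_sum fun j _ => ?_
          refine (setIntegral_abs_fderiv_apply_le hK hΩ.measurableSet hb hu
            (norm_single_one_le j) hhpos fun x hx s hs => hthick ?_).trans (by gcongr)
          refine Metric.mem_cthickening_of_dist_le _ x _ _ hx ?_
          rw [dist_self_add_left, norm_smul, Real.norm_of_nonneg hs.1]
          calc s * ‖(Pi.single j 1 : ℝ3)‖ ≤ h * 1 :=
                mul_le_mul hs.2 (norm_single_one_le j) (norm_nonneg _) hhpos.le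
            _ ≤ h₀ := by rw [mul_one]; exact min_le_left _ _
      _ = _ := by simp [mul_add]
  have hout : ∫ x in Ω \ K, ‖fderiv ℝ u x‖ ≤ τ * M := by
    calc ∫ x in Ω \ K, ‖fderiv ℝ u x‖ ≤ ∫ _ in Ω \ K, M :=
          setIntegral_mono_on (ig.mono_set sdiff_subset) ((iconst M).mono_set sdiff_subset)
            (hΩ.measurableSet.diff hK.measurableSet) fun x hx => hMu x hx.1
      _ = volume.real (Ω \ K) * M := by simp
      _ ≤ τ * M := by gcongr
  have hsplit : ∫ x in Ω, ‖fderiv ℝ u x‖ =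
      (∫ x in K, ‖fderiv ℝ u x‖) + ∫ x in Ω \ K, ‖fderiv ℝ u x‖ := by
    rw [← integral_inter_add_sdiff hK.measurableSet ig, inter_eq_self_of_subset_right hKΩ]
  rw [integral_add iu ig, hsplit]
  have e1 : (1 + 6 / h) * (∫ x in Ω, |u x|) ≤ (1 + 6 / h) * (t * m + 1 / t * A) := by gcongr
  have e2 : 3 * h * (m + H) ≤ τ / 2 * (1 + H) := by
    calc 3 * h * (m + H) ≤ 3 * h * ((m + 1) * (1 + H)) := by gcongr; nlinarith
      _ = 3 * h * (m + 1) * (1 + H) := by ring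
      _ ≤ _ := by gcongr
  have e3 : 0 ≤ τ * H := by positivity
  have e4 : (1 + 6 / h) * (t * m + 1 / t * A) =
    (1 + 6 / h) * (t * m) + (1 + 6 / h) * (1 / t) * A := by ring
  have e5 : 3 * (2 / h * (∫ x in Ω, |u x|) + h * (m + H)) =
    6 / h * (∫ x in Ω, |u x|) + 3 * h * (m + H) := by ring
  linarith

/-- The integrand of the `q`-th power of the `W^{2,q}`-norm. -/
def sobolevDensity {F : Type*} [NormedAddCommGroup F] [NormedSpace ℝ F] (q : ℝ) (u : ℝ3 → F)
    (x : ℝ3) : ℝ :=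
  ‖u x‖ ^ q + ‖fderiv ℝ u x‖ ^ q + ‖iteratedFDeriv ℝ 2 u x‖ ^ q

lemma sobolevDensity_nonneg {F : Type*} [NormedAddCommGroup F] [NormedSpace ℝ F] (q : ℝ)
    (u : ℝ3 → F) (x : ℝ3) : 0 ≤ sobolevDensity q u x := by
  unfold sobolevDensity; positivity

lemma continuous_sobolevDensity {F : Type*} [NormedAddCommGroup F] [NormedSpace ℝ F] {q : ℝ}
    (hq : 0 ≤ q) {u : ℝ3 → F} (hu : ContDiff ℝ 2 u) : Continuous (sobolevDensity q u) := by
  have h1 : Continuous (fderiv ℝ u) := hu.continuous_fderiv (by norm_num)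
  have h2 : Continuous (iteratedFDeriv ℝ 2 u) := hu.continuous_iteratedFDeriv le_rfl
  exact ((hu.continuous.norm.rpow_const fun _ => Or.inr hq).add
    (h1.norm.rpow_const fun _ => Or.inr hq)).add (h2.norm.rpow_const fun _ => Or.inr hq)

lemma Real.add_add_rpow_le {a b c q : ℝ} (ha : 0 ≤ a) (hb : 0 ≤ b) (hc : 0 ≤ c) (hq : 0 ≤ q) :
    (a + b + c) ^ q ≤ 3 ^ q * (a ^ q + b ^ q + c ^ q) := by
  have ha' := Real.rpow_nonneg ha q
  have hb' := Real.rpow_nonneg hb q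
  have hc' := Real.rpow_nonneg hc q
  obtain ⟨m, hm0, hm, hmle⟩ : ∃ m, 0 ≤ m ∧ a + b + c ≤ 3 * m ∧ m ^ q ≤ a ^ q + b ^ q + c ^ q := by
    rcases le_total a b with h1 | h1 <;> rcases le_total b c with h2 | h2 <;>
      rcases le_total a c with h3 | h3
    all_goals first
      | exact ⟨a, ha, by linarith, by linarith⟩
      | exact ⟨b, hb, by linarith, by linarith⟩
      | exact ⟨c, hc, by linarith, by linarith⟩
  calc (a + b + c) ^ q ≤ (3 * m) ^ q := by gcongr
    _ = 3 ^ q * m ^ q := Real.mul_rpow (by norm_num) hm0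
    _ ≤ _ := by gcongr

/-- A function of the first coordinate, vanishing at `x` with unit slope, of amplitude `r`. -/
def sineWave (r : ℝ) (x y : ℝ3) : ℝ := r * Real.sin ((y 0 - x 0) / r)

section sineWave

variable {r : ℝ} (x : ℝ3)

lemma contDiff_sineWave : ContDiff ℝ 2 (sineWave r x) := by
  unfold sineWave
  fun_prop

lemma sineWave_self : sineWave r x x = 0 := by simp [sineWave]

lemma abs_sineWave_le (hr : 0 < r) (y : ℝ3) : |sineWave r x y| ≤ r := by
  rw [sineWave, abs_mul, abs_of_pos hr]
  exact mul_le_of_le_one_right hr.le (Real.abs_sin_le_one _)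

lemma hasFDerivAt_sineWave (hr : 0 < r) (y : ℝ3) :
    HasFDerivAt (sineWave r x)
      (Real.cos ((y 0 - x 0) / r) • (ContinuousLinearMap.proj 0 : ℝ3 →L[ℝ] ℝ)) y := by
  have h1 : HasDerivAt (fun t : ℝ => r * Real.sin ((t - x 0) / r))
      (Real.cos ((y 0 - x 0) / r)) (y 0) := by
    have h := ((((hasDerivAt_id (y 0)).sub_const (x 0)).div_const r).sin).const_mul r
    have hr' : r * (Real.cos ((y 0 - x 0) / r) * (1 / r)) = Real.cos ((y 0 - x 0) / r) := by
      field_simp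
    rw [← hr']
    exact h
  exact HasDerivAt.comp_hasFDerivAt (f := (ContinuousLinearMap.proj 0 : ℝ3 →L[ℝ] ℝ)) y h1
    (ContinuousLinearMap.proj 0 : ℝ3 →L[ℝ] ℝ).hasFDerivAt

lemma norm_proj_zero_le : ‖(ContinuousLinearMap.proj 0 : ℝ3 →L[ℝ] ℝ)‖ ≤ 1 :=
  ContinuousLinearMap.opNorm_le_bound _ zero_le_one fun v => by
    simpa using norm_le_pi_norm v 0

lemma norm_fderiv_sineWave_le (hr : 0 < r) (y : ℝ3) : ‖fderiv ℝ (sineWave r x) y‖ ≤ 1 := by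
  rw [(hasFDerivAt_sineWave x hr y).fderiv, norm_smul]
  exact mul_le_one₀ (Real.abs_cos_le_one _) (norm_nonneg _) norm_proj_zero_le

lemma norm_iteratedFDeriv_two_sineWave_le (hr : 0 < r) (y : ℝ3) :
    ‖iteratedFDeriv ℝ 2 (sineWave r x) y‖ ≤ 1 / r := by
  rw [← norm_fderiv_fderiv_eq]
  have h0 : fderiv ℝ (sineWave r x) = fun y =>
      Real.cos ((y 0 - x 0) / r) • (ContinuousLinearMap.proj 0 : ℝ3 →L[ℝ] ℝ) :=
    funext fun y => (hasFDerivAt_sineWave x hr y).fderiv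
  have h1 : HasDerivAt (fun t : ℝ => Real.cos ((t - x 0) / r))
      (-Real.sin ((y 0 - x 0) / r) * (1 / r)) (y 0) :=
    (((hasDerivAt_id (y 0)).sub_const (x 0)).div_const r).cos
  have h2 := (HasDerivAt.comp_hasFDerivAt (f := (ContinuousLinearMap.proj 0 : ℝ3 →L[ℝ] ℝ)) y h1
    (ContinuousLinearMap.proj 0 : ℝ3 →L[ℝ] ℝ).hasFDerivAt).smul_const
      (ContinuousLinearMap.proj 0 : ℝ3 →L[ℝ] ℝ)
  rw [h0]
  erw [h2.fderiv]
  rw [ContinuousLinearMap.norm_smulRight_apply, norm_smul, norm_mul, norm_neg,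
    Real.norm_of_nonneg (by positivity : 0 ≤ 1 / r)]
  have := norm_proj_zero_le
  have hs : ‖Real.sin ((y 0 - x 0) / r)‖ ≤ 1 := Real.abs_sin_le_one _
  calc _ ≤ 1 * (1 / r) * 1 * 1 := by gcongr
    _ = 1 / r := by ring

lemma abs_le_norm_fderiv_mul_sineWave (hr : 0 < r) {u : ℝ3 → ℝ} (hu : ContDiff ℝ 2 u) :
    |u x| ≤ ‖fderiv ℝ (fun y => u y * sineWave r x y) x‖ := by
  have h := ((hu.differentiable (by norm_num)) x).hasFDerivAt.mul (hasFDerivAt_sineWave x hr x)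
  have hval : fderiv ℝ (fun y => u y * sineWave r x y) x (Pi.single 0 1) = u x := by
    erw [h.fderiv]
    simp [sineWave_self]
  calc |u x| = ‖fderiv ℝ (fun y => u y * sineWave r x y) x (Pi.single 0 1)‖ := by
        rw [hval, Real.norm_eq_abs]
    _ ≤ _ := (ContinuousLinearMap.le_opNorm _ _).trans
        (mul_le_of_le_one_right (norm_nonneg _) (norm_single_one_le 0))

lemma sobolevDensity_mul_sineWave_le (hr : 0 < r) (hr1 : r ≤ 1) {q : ℝ} (hq : 0 ≤ q)
    {u : ℝ3 → ℝ} (hu : ContDiff ℝ 2 u) (y : ℝ3) :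
    sobolevDensity q (fun y => u y * sineWave r x y) y ≤
      3 * 6 ^ q * (r ^ q * ‖iteratedFDeriv ℝ 2 u y‖ ^ q +
        r ^ (-q) * (‖u y‖ ^ q + ‖fderiv ℝ u y‖ ^ q)) := by
  have hψ : ContDiff ℝ 2 (sineWave r x) := contDiff_sineWave x
  have b0 : ‖sineWave r x y‖ ≤ r := abs_sineWave_le x hr y
  have b1 := norm_fderiv_sineWave_le x hr y
  have b2 := norm_iteratedFDeriv_two_sineWave_le x hr y
  set a := ‖u y‖
  set b := ‖fderiv ℝ u y‖ with hb
  set c := ‖iteratedFDeriv ℝ 2 u y‖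
  have ha0 : 0 ≤ a := norm_nonneg _
  have hb0 : 0 ≤ b := norm_nonneg _
  have hc0 : 0 ≤ c := norm_nonneg _
  have hrr : 1 ≤ 1 / r := by rwa [le_div_iff₀ hr, one_mul]
  have d0 : ‖u y * sineWave r x y‖ ≤ r * c + 2 * (b / r) + 2 * (a / r) := by
    rw [norm_mul]
    have h1 : a * ‖sineWave r x y‖ ≤ a * (1 / r) := by gcongr; linarith
    have h2 : 0 ≤ r * c + 2 * (b / r) + a / r := by positivity
    have h3 : a * (1 / r) = a / r := by ring
    linarith
  have d1 : ‖fderiv ℝ (fun y => u y * sineWave r x y) y‖ ≤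
      r * c + 2 * (b / r) + 2 * (a / r) := by
    have h := norm_iteratedFDeriv_mul_le hu hψ y (n := 1) (by norm_num)
    rw [norm_iteratedFDeriv_one] at h
    simp only [Finset.sum_range_succ, Finset.sum_range_zero, Nat.choose_zero_right,
      Nat.choose_self, norm_iteratedFDeriv_zero, Nat.sub_zero, Nat.reduceSub,
      norm_iteratedFDeriv_one, Nat.cast_one, one_mul, zero_add] at h
    have h1 : a * ‖fderiv ℝ (sineWave r x) y‖ ≤ a * (1 / r) := by gcongr; linarith
    have h2 : b * ‖sineWave r x y‖ ≤ b * (1 / r) := by gcongr; linarith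
    have h3 : 0 ≤ r * c + b / r + a / r := by positivity
    have h4 : a * (1 / r) = a / r := by ring
    have h5 : b * (1 / r) = b / r := by ring
    linarith
  have d2 : ‖iteratedFDeriv ℝ 2 (fun y => u y * sineWave r x y) y‖ ≤
      r * c + 2 * (b / r) + 2 * (a / r) := by
    have h := norm_iteratedFDeriv_mul_le hu hψ y (n := 2) (by norm_num)
    simp only [Finset.sum_range_succ, Finset.sum_range_zero, Nat.choose_zero_right,
      Nat.choose_self, norm_iteratedFDeriv_zero, Nat.sub_zero,
      norm_iteratedFDeriv_one, Nat.cast_one, one_mul, zero_add, Nat.choose_one_right,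
      Nat.reduceSub, Nat.cast_ofNat] at h
    have h1 : a * ‖iteratedFDeriv ℝ 2 (sineWave r x) y‖ ≤ a * (1 / r) := by gcongr
    have h2 : 2 * b * ‖fderiv ℝ (sineWave r x) y‖ ≤ 2 * b * (1 / r) := by gcongr; linarith
    have h3 : c * ‖sineWave r x y‖ ≤ c * r := by gcongr
    have h4 : 0 ≤ a / r := by positivity
    have h5 : a * (1 / r) = a / r := by ring
    have h6 : 2 * b * (1 / r) = 2 * (b / r) := by ring
    linarith
  have key : (r * c + 2 * (b / r) + 2 * (a / r)) ^ q ≤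
      6 ^ q * (r ^ q * c ^ q + r ^ (-q) * (a ^ q + b ^ q)) := by
    have h6 : (6 : ℝ) ^ q = 3 ^ q * 2 ^ q := by
      rw [← Real.mul_rpow (by norm_num) (by norm_num)]; norm_num
    have h2 : 1 ≤ (2 : ℝ) ^ q := Real.one_le_rpow (by norm_num) hq
    refine (Real.add_add_rpow_le (by positivity) (by positivity) (by positivity) hq).trans ?_
    rw [Real.mul_rpow hr.le hc0, Real.mul_rpow (by norm_num) (by positivity),
      Real.mul_rpow (by norm_num) (by positivity), Real.div_rpow hb0 hr.le,
      Real.div_rpow ha0 hr.le, Real.rpow_neg hr.le, h6, mul_assoc]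
    have h7 : 0 ≤ r ^ q * c ^ q := by positivity
    have h8 : r ^ q * c ^ q ≤ 2 ^ q * (r ^ q * c ^ q) := le_mul_of_one_le_left h7 h2
    gcongr ?_ * ?_
    calc r ^ q * c ^ q + 2 ^ q * (b ^ q / r ^ q) + 2 ^ q * (a ^ q / r ^ q)
        ≤ 2 ^ q * (r ^ q * c ^ q) + 2 ^ q * (b ^ q / r ^ q) + 2 ^ q * (a ^ q / r ^ q) := by
          gcongr
      _ = _ := by ring
  have p0 := (Real.rpow_le_rpow (norm_nonneg _) d0 hq).trans key
  have p1 := (Real.rpow_le_rpow (norm_nonneg _) d1 hq).trans key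
  have p2 := (Real.rpow_le_rpow (norm_nonneg _) d2 hq).trans key
  unfold sobolevDensity
  linarith

end sineWave

lemma abs_rpow_le_of_gradient_embedding {Ω P : Set ℝ3} (hb : Bornology.IsBounded Ω) {q : ℝ}
    (hq : 0 ≤ q) {C : ℝ} (hC : 0 ≤ C)
    (hemb : ∀ ψ : ℝ3 → ℝ, ContDiff ℝ 2 ψ → (∀ y ∈ P, ψ y = 0) → ∀ x ∈ closure Ω,
      ‖fderiv ℝ ψ x‖ ^ q ≤ C * ∫ y in Ω, sobolevDensity q ψ y)
    {u : ℝ3 → ℝ} (hu : ContDiff ℝ 2 u) (huP : ∀ y ∈ P, u y = 0) {x : ℝ3} (hx : x ∈ closure Ω)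
    {r : ℝ} (hr : 0 < r) (hr1 : r ≤ 1) :
    |u x| ^ q ≤ C * (3 * 6 ^ q) * (r ^ q * (∫ y in Ω, ‖iteratedFDeriv ℝ 2 u y‖ ^ q) +
      r ^ (-q) * ∫ y in Ω, (‖u y‖ ^ q + ‖fderiv ℝ u y‖ ^ q)) := by
  have hψ : ContDiff ℝ 2 fun y => u y * sineWave r x y := hu.mul (contDiff_sineWave x)
  have h1 : Continuous (fderiv ℝ u) := hu.continuous_fderiv (by norm_num)
  have h2 : Continuous (iteratedFDeriv ℝ 2 u) := hu.continuous_iteratedFDeriv le_rfl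
  have i2 : IntegrableOn (fun y => ‖iteratedFDeriv ℝ 2 u y‖ ^ q) Ω :=
    (h2.norm.rpow_const fun _ => Or.inr hq).integrableOn_of_isBounded hb
  have i1 : IntegrableOn (fun y => ‖u y‖ ^ q + ‖fderiv ℝ u y‖ ^ q) Ω :=
    ((hu.continuous.norm.rpow_const fun _ => Or.inr hq).add
      (h1.norm.rpow_const fun _ => Or.inr hq)).integrableOn_of_isBounded hb
  calc |u x| ^ q ≤ ‖fderiv ℝ (fun y => u y * sineWave r x y) x‖ ^ q := by
        gcongr; exact abs_le_norm_fderiv_mul_sineWave x hr hu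
    _ ≤ C * ∫ y in Ω, sobolevDensity q (fun y => u y * sineWave r x y) y :=
        hemb _ hψ (fun y hy => by simp [huP y hy]) x hx
    _ ≤ C * ∫ y in Ω, 3 * 6 ^ q * (r ^ q * ‖iteratedFDeriv ℝ 2 u y‖ ^ q +
          r ^ (-q) * (‖u y‖ ^ q + ‖fderiv ℝ u y‖ ^ q)) := by
        gcongr ?_ * ?_
        exact integral_mono ((continuous_sobolevDensity hq hψ).integrableOn_of_isBounded hb)
          (((i2.const_mul _).add (i1.const_mul _)).const_mul _)
          fun y => sobolevDensity_mul_sineWave_le x hr hr1 hq hu y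
    _ = _ := by
        rw [integral_const_mul, integral_add (i2.const_mul _) (i1.const_mul _),
          integral_const_mul, integral_const_mul]
        ring

/-- If gradients of functions vanishing on `P` are controlled by their `W^{2,q}`-norm, then among
such functions with bounded second derivatives, smallness in `L²` forces uniform smallness. -/
lemma exists_forall_abs_le_of_gradient_embedding {Ω P : Set ℝ3} (hΩ : IsOpen Ω)
    (hb : Bornology.IsBounded Ω) {q : ℝ} (hq : 1 < q) {C : ℝ} (hC : 0 ≤ C)
    (hemb : ∀ ψ : ℝ3 → ℝ, ContDiff ℝ 2 ψ → (∀ y ∈ P, ψ y = 0) → ∀ x ∈ closure Ω,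
      ‖fderiv ℝ ψ x‖ ^ q ≤ C * ∫ y in Ω, sobolevDensity q ψ y)
    {H σ : ℝ} (hH : 0 ≤ H) (hσ : 0 < σ) :
    ∃ Γ > 0, ∀ u : ℝ3 → ℝ, ContDiff ℝ 2 u → (∀ y ∈ P, u y = 0) →
      ∫ y in Ω, ‖iteratedFDeriv ℝ 2 u y‖ ^ q ≤ H → ∫ y in Ω, u y ^ 2 ≤ Γ →
      ∀ x ∈ closure Ω, |u x| ≤ σ := by
  have hq0 : 0 < q := by linarith
  set D := C * (3 * 6 ^ q) + C + 1 with hD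
  have h6 : 0 ≤ C * (3 * 6 ^ q) := by positivity
  have hD1 : C * (3 * 6 ^ q) ≤ D := by linarith
  have hD2 : C ≤ D := by linarith
  have hDpos : 0 < D := by linarith
  obtain ⟨C₁, hC₁, hint₁⟩ := exists_const_setIntegral_add_norm_fderiv_le hΩ hb hq.le
    (τ := 1 / (2 * D)) (by positivity)
  set M₀ := 2 * D * H + 1 + H + 2 * D * C₁ + 1 with hM₀
  have hM₀1 : 1 ≤ M₀ := by
    have : 0 ≤ 2 * D * H + 1 + H + 2 * D * C₁ := by positivity
    linarith
  set r := min 1 ((σ ^ q / (2 * D * (H + 1))) ^ q⁻¹) with hr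
  have hrpos : 0 < r := by positivity
  have hr1 : r ≤ 1 := min_le_left _ _
  have hrH : D * (r ^ q * H) ≤ σ ^ q / 2 := by
    have h1 : r ^ q ≤ σ ^ q / (2 * D * (H + 1)) := by
      calc r ^ q ≤ ((σ ^ q / (2 * D * (H + 1))) ^ q⁻¹) ^ q := by
            gcongr; exact min_le_right _ _
        _ = _ := Real.rpow_inv_rpow (by positivity) hq0.ne'
    calc D * (r ^ q * H) ≤ D * (σ ^ q / (2 * D * (H + 1)) * (H + 1)) := by
          gcongr; linarith
      _ = σ ^ q / 2 := by field_simp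
  set B := D * (r ^ (-q) * M₀ ^ (q - 1)) with hB
  have hBpos : 0 < B := by positivity
  obtain ⟨C₂, hC₂, hint₂⟩ := exists_const_setIntegral_add_norm_fderiv_le hΩ hb hq.le
    (τ := σ ^ q / (4 * B * (1 + M₀ + H))) (by positivity)
  refine ⟨min 1 (σ ^ q / (4 * B * (C₂ + 1))), by positivity, fun u hu huP huH huA x hx => ?_⟩
  have h1c : Continuous (fderiv ℝ u) := hu.continuous_fderiv (by norm_num)
  have hc0 : Continuous u := hu.continuous
  obtain ⟨x₀, hx₀, hmax⟩ := hb.isCompact_closure.exists_isMaxOn ⟨x, hx⟩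
    (f := fun y => max |u y| ‖fderiv ℝ u y‖) (by fun_prop)
  set M := max |u x₀| ‖fderiv ℝ u x₀‖ with hM
  have hM0 : 0 ≤ M := le_max_of_le_left (abs_nonneg _)
  have hMu : ∀ y ∈ Ω, |u y| ≤ M := fun y hy =>
    (le_max_left _ _).trans (hmax (subset_closure hy))
  have hMg : ∀ y ∈ Ω, ‖fderiv ℝ u y‖ ≤ M := fun y hy =>
    (le_max_right _ _).trans (hmax (subset_closure hy))
  set s := ∫ y in Ω, (|u y| + ‖fderiv ℝ u y‖) with hs
  set A := ∫ y in Ω, u y ^ 2 with hA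
  set H' := ∫ y in Ω, ‖iteratedFDeriv ℝ 2 u y‖ ^ q with hH'
  have hH'0 : 0 ≤ H' := integral_nonneg fun _ => by positivity
  have hA0 : 0 ≤ A := integral_nonneg fun _ => sq_nonneg _
  have hs0 : 0 ≤ s := integral_nonneg fun _ => by positivity
  have hpow : ∀ a : ℝ, 0 ≤ a → a ≤ M → a ^ q ≤ M ^ (q - 1) * a := fun a ha haM => by
    rcases ha.eq_or_lt with rfl | hapos
    · simp [Real.zero_rpow hq0.ne']
    · calc a ^ q = a ^ (q - 1) * a := by
            rw [← Real.rpow_add_one hapos.ne', sub_add_cancel]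
        _ ≤ M ^ (q - 1) * a := by gcongr
  have hlow : ∫ y in Ω, (‖u y‖ ^ q + ‖fderiv ℝ u y‖ ^ q) ≤ M ^ (q - 1) * s := by
    rw [hs, ← integral_const_mul]
    refine setIntegral_mono_on ?_ ?_ hΩ.measurableSet fun y hy => ?_
    · exact ((hu.continuous.norm.rpow_const fun _ => Or.inr hq0.le).add
        (h1c.norm.rpow_const fun _ => Or.inr hq0.le)).integrableOn_of_isBounded hb
    · exact Continuous.integrableOn_of_isBounded hb (by fun_prop)
    · rw [mul_add, Real.norm_eq_abs]
      exact add_le_add (hpow _ (abs_nonneg _) (hMu y hy)) (hpow _ (norm_nonneg _) (hMg y hy))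
  have hMle : M ^ q ≤ D * (H + M ^ (q - 1) * s) := by
    have hE : H' + ∫ y in Ω, (‖u y‖ ^ q + ‖fderiv ℝ u y‖ ^ q) ≤ H + M ^ (q - 1) * s :=
      add_le_add huH hlow
    rcases max_choice |u x₀| ‖fderiv ℝ u x₀‖ with h | h
    · rw [hM, h]
      have := abs_rpow_le_of_gradient_embedding hb hq0.le hC hemb hu huP hx₀ one_pos le_rfl
      simp only [Real.one_rpow, one_mul] at this
      exact this.trans (by rw [← h, ← hM]; gcongr)
    · rw [hM, h]
      have h1 := hemb u hu huP x₀ hx₀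
      have h2 : ∫ y in Ω, sobolevDensity q u y =
          H' + ∫ y in Ω, (‖u y‖ ^ q + ‖fderiv ℝ u y‖ ^ q) := by
        unfold sobolevDensity
        have i1 : IntegrableOn (fun y => ‖u y‖ ^ q + ‖fderiv ℝ u y‖ ^ q) Ω :=
          ((hu.continuous.norm.rpow_const fun _ => Or.inr hq0.le).add
            (h1c.norm.rpow_const fun _ => Or.inr hq0.le)).integrableOn_of_isBounded hb
        have i2 : IntegrableOn (fun y => ‖iteratedFDeriv ℝ 2 u y‖ ^ q) Ω :=
          ((hu.continuous_iteratedFDeriv le_rfl).norm.rpow_const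
            fun _ => Or.inr hq0.le).integrableOn_of_isBounded hb
        rw [integral_add i1 i2, add_comm]
      rw [h2] at h1
      exact h1.trans (by rw [← h, ← hM]; gcongr)
  have hMM₀ : M ≤ M₀ := by
    by_contra! hlt
    have hM1 : 1 < M := hM₀1.trans_lt hlt
    have hMpos : 0 < M := by linarith
    have hMq : 1 ≤ M ^ (q - 1) := Real.one_le_rpow hM1.le (by linarith)
    have h1 : M ^ (q - 1) * M ≤ M ^ (q - 1) * (D * (H + s)) := by
      calc M ^ (q - 1) * M = M ^ q := by
            rw [← Real.rpow_add_one hMpos.ne', sub_add_cancel]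
        _ ≤ D * (H + M ^ (q - 1) * s) := hMle
        _ ≤ D * (M ^ (q - 1) * H + M ^ (q - 1) * s) := by
            gcongr; exact le_mul_of_one_le_left hH hMq
        _ = _ := by ring
    have h2 : M ≤ D * (H + s) := le_of_mul_le_mul_left h1 (by linarith)
    have h3 : s ≤ 1 / (2 * D) * (1 + M + H) + C₁ * 1 := by
      refine (hint₁ u hu M hM0 hMg).trans ?_
      have hA1 : A ≤ 1 := huA.trans (min_le_left _ _)
      gcongr
    have h4 : D * s ≤ (1 + M + H) / 2 + D * C₁ := by
      calc D * s ≤ D * (1 / (2 * D) * (1 + M + H) + C₁ * 1) := by gcongr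
        _ = _ := by field_simp
    linarith
  have hs2 : B * s ≤ σ ^ q / 2 := by
    have h3 : s ≤ σ ^ q / (4 * B * (1 + M₀ + H)) * (1 + M₀ + H) +
        (C₂ + 1) * (σ ^ q / (4 * B * (C₂ + 1))) := by
      refine (hint₂ u hu M hM0 hMg).trans ?_
      have hA1 : A ≤ σ ^ q / (4 * B * (C₂ + 1)) := huA.trans (min_le_right _ _)
      gcongr
      linarith
    calc B * s ≤ B * (σ ^ q / (4 * B * (1 + M₀ + H)) * (1 + M₀ + H) +
        (C₂ + 1) * (σ ^ q / (4 * B * (C₂ + 1)))) := by gcongr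
      _ = σ ^ q / 2 := by field_simp; ring
  have hfin : |u x| ^ q ≤ σ ^ q := by
    calc |u x| ^ q ≤ C * (3 * 6 ^ q) * (r ^ q * H' +
          r ^ (-q) * ∫ y in Ω, (‖u y‖ ^ q + ‖fderiv ℝ u y‖ ^ q)) :=
          abs_rpow_le_of_gradient_embedding hb hq0.le hC hemb hu huP hx hrpos hr1
      _ ≤ D * (r ^ q * H + r ^ (-q) * (M₀ ^ (q - 1) * s)) := by
          have hl : ∫ y in Ω, (‖u y‖ ^ q + ‖fderiv ℝ u y‖ ^ q) ≤ M₀ ^ (q - 1) * s :=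
            hlow.trans (by gcongr)
          have hl0 : 0 ≤ ∫ y in Ω, (‖u y‖ ^ q + ‖fderiv ℝ u y‖ ^ q) :=
            integral_nonneg fun _ => by positivity
          gcongr
      _ = D * (r ^ q * H) + B * s := by rw [hB]; ring
      _ ≤ σ ^ q := by linarith
  exact (Real.rpow_le_rpow_iff (abs_nonneg _) hσ.le hq0).1 hfin

lemma subset_closure_of_ae_restrict {Ω : Set ℝ3} (hΩ : IsOpen Ω) {p : ℝ3 → Prop}
    (hp : ∀ᵐ x ∂(volume.restrict Ω), p x) : Ω ⊆ closure {x ∈ Ω | p x} := by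
  intro x hx
  rw [mem_closure_iff]
  intro U hU hxU
  by_contra hne
  have hpos := (hU.inter hΩ).measure_pos volume ⟨x, hxU, hx⟩
  rw [ae_restrict_iff' hΩ.measurableSet, ae_iff] at hp
  refine hpos.ne' (measure_mono_null (fun y hy => ?_) hp)
  simp only [mem_ofPred_eq, Classical.not_imp]
  exact ⟨hy.2, fun hpy => hne ⟨y, hy.1, hy.2, hpy⟩⟩

lemma continuous_Jdet {η : ℝ3 → ℝ3} (hη : ContDiff ℝ 2 η) : Continuous (Jdet η) := by
  have h : ∀ i : Fin 3, Continuous (fderiv ℝ fun Y => η Y i) := fun i =>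
    (contDiff_pi.1 hη i).continuous_fderiv (by norm_num)
  refine Continuous.matrix_det (continuous_matrix fun i j => ?_)
  exact (h i).clm_apply continuous_const

lemma grad_apply_eq {η : ℝ3 → ℝ3} (hη : ContDiff ℝ 2 η) (X : ℝ3) (i j : Fin 3) :
    grad η X i j = fderiv ℝ η X (Pi.single j 1) i := by
  simp only [grad, Matrix.of_apply]
  rw [fderiv_apply ((hη.differentiable (by norm_num)) X)]
  rfl

/-- Perturbing a deformation in the direction of its `k`-th partial derivative at `x` changes the
Jacobian determinant at `x` by a scalar factor. -/
lemma Jdet_add_smul_column {η : ℝ3 → ℝ3} (hη : ContDiff ℝ 2 η) {ψ : ℝ3 → ℝ}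
    (hψ : ContDiff ℝ 2 ψ) (x : ℝ3) (k : Fin 3) (c : ℝ) :
    Jdet (fun y => η y + ψ y • (c • fderiv ℝ η x (Pi.single k 1))) x =
      (1 + c * fderiv ℝ ψ x (Pi.single k 1)) * Jdet η x := by
  have hentry : ∀ i j, grad (fun y => η y + ψ y • (c • fderiv ℝ η x (Pi.single k 1))) x i j =
      grad η x i j + fderiv ℝ ψ x (Pi.single j 1) * (c * grad η x i k) := fun i j => by
    have h1 := ((contDiff_pi.1 hη i).differentiable (by norm_num) x).hasFDerivAt
    have h2 := ((hψ.differentiable (by norm_num) x).hasFDerivAt).mul_const (c * grad η x i k)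
    have h3 := h1.add h2
    rw [grad_apply_eq hη x i k] at h3
    have h4 : grad (fun y => η y + ψ y • (c • fderiv ℝ η x (Pi.single k 1))) x i j =
        (fderiv ℝ (fun y => η y i) x + (c * fderiv ℝ η x (Pi.single k 1) i) • fderiv ℝ ψ x)
          (Pi.single j 1) := congrArg (fun L : ℝ3 →L[ℝ] ℝ => L (Pi.single j 1)) h3.fderiv
    rw [h4, grad_apply_eq hη x i k]
    simp [grad, mul_comm]
  rw [Jdet, Jdet, Matrix.det_fin_three, Matrix.det_fin_three]
  simp only [hentry]
  fin_cases k <;> simp only [Fin.zero_eta, Fin.mk_one, Fin.reduceFinMk] <;> ring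

lemma sobolevDensity_smul_const_le {q : ℝ} (hq : 0 ≤ q) {ψ : ℝ3 → ℝ} (hψ : ContDiff ℝ 2 ψ)
    (w y : ℝ3) :
    sobolevDensity q (fun y => ψ y • w) y ≤ ‖w‖ ^ q * sobolevDensity q ψ y := by
  set L : ℝ →L[ℝ] ℝ3 := ContinuousLinearMap.toSpanSingleton ℝ w
  have hL : (fun y => ψ y • w) = L ∘ ψ := by
    ext y; simp [L]
  have hLn : ‖L‖ = ‖w‖ := ContinuousLinearMap.norm_toSpanSingleton w
  have h1 := L.norm_iteratedFDeriv_comp_left (n := 1) (hψ.contDiffAt (x := y)) (by norm_num)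
  have h2 := L.norm_iteratedFDeriv_comp_left (n := 2) (hψ.contDiffAt (x := y)) (by norm_num)
  rw [norm_iteratedFDeriv_one, norm_iteratedFDeriv_one] at h1
  rw [← hL, hLn] at h1 h2
  have p0 : ‖ψ y • w‖ ^ q ≤ ‖w‖ ^ q * ‖ψ y‖ ^ q := by
    rw [norm_smul, mul_comm, Real.mul_rpow (norm_nonneg _) (norm_nonneg _)]
  have p1 := (Real.rpow_le_rpow (norm_nonneg _) h1 hq).trans_eq
    (Real.mul_rpow (norm_nonneg _) (norm_nonneg _))
  have p2 := (Real.rpow_le_rpow (norm_nonneg _) h2 hq).trans_eq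
    (Real.mul_rpow (norm_nonneg _) (norm_nonneg _))
  unfold sobolevDensity
  linarith

namespace ElasticSetting

lemma memW2q_of_contDiff (S : ElasticSetting) {η : ℝ3 → ℝ3} (hη : ContDiff ℝ 2 η) :
    S.MemW2q η :=
  ⟨hη, (continuous_sobolevDensity (by linarith [S.hq]) hη).integrableOn_of_isBounded S.boundedΩ0⟩

lemma W2qDist_self_add (S : ElasticSetting) {η φ : ℝ3 → ℝ3} (hη : ContDiff ℝ 2 η)
    (hφ : ContDiff ℝ 2 φ) :
    S.W2qDist η (fun y => η y + φ y) = (∫ X in S.Ω0, sobolevDensity S.q φ X) ^ (1 / S.q) := by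
  unfold W2qDist sobolevDensity
  congr 2
  ext X
  have h1 : fderiv ℝ (fun y => η y + φ y) X = fderiv ℝ η X + fderiv ℝ φ X :=
    fderiv_fun_add (hη.differentiable (by norm_num) X) (hφ.differentiable (by norm_num) X)
  have h2 : iteratedFDeriv ℝ 2 (fun y => η y + φ y) X =
      iteratedFDeriv ℝ 2 η X + iteratedFDeriv ℝ 2 φ X :=
    iteratedFDeriv_add_apply hη.contDiffAt hφ.contDiffAt
  rw [h1, h2]
  simp only [sub_add_cancel_left, norm_neg]

/-- At an interior point of the admissible set, positivity of the Jacobian of all small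
perturbations forces a gradient bound for functions vanishing on `P` by their `W^{2,q}`-norm. -/
lemma exists_gradient_embedding_of_memIntE (S : ElasticSetting) {η₀ : ℝ3 → ℝ3}
    (hη₀ : S.memIntE η₀) :
    ∃ C, 0 ≤ C ∧ ∀ ψ : ℝ3 → ℝ, ContDiff ℝ 2 ψ → (∀ y ∈ S.P, ψ y = 0) → ∀ x ∈ closure S.Ω0,
      ‖fderiv ℝ ψ x‖ ^ S.q ≤ C * ∫ y in S.Ω0, sobolevDensity S.q ψ y := by
  obtain ⟨hE, ε, hε, hball⟩ := hη₀
  have hq : 0 < S.q := by linarith [S.hq]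
  have hc : ContDiff ℝ 2 η₀ := hE.1.1
  have hc1 : Continuous (fderiv ℝ η₀) := hc.continuous_fderiv (by norm_num)
  obtain ⟨B, hB⟩ := S.boundedΩ0.isCompact_closure.exists_bound_of_continuousOn hc1.continuousOn
  have hB0 : 0 ≤ B := by
    obtain ⟨x, hx⟩ := S.nonemptyΩ0
    exact (norm_nonneg _).trans (hB x (subset_closure hx))
  refine ⟨(3 * (2 * B / ε)) ^ S.q, by positivity, fun ψ hψ hψP x hx => ?_⟩
  set J := ∫ y in S.Ω0, sobolevDensity S.q ψ y with hJ
  have hJ0 : 0 ≤ J := integral_nonneg fun y => sobolevDensity_nonneg _ _ _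
  have hgood : ∀ x ∈ S.Ω0, 0 < Jdet η₀ x → ∀ k : Fin 3,
      |fderiv ℝ ψ x (Pi.single k 1)| ≤ 2 * B / ε * J ^ (1 / S.q) := by
    intro x hx hdet k
    by_contra! hlt
    set p := fderiv ℝ ψ x (Pi.single k 1) with hp
    have hp0 : 0 < |p| := lt_of_le_of_lt (by positivity) hlt
    set w := (-2 / p) • fderiv ℝ η₀ x (Pi.single k 1) with hw
    have hwn : ‖w‖ ≤ 2 / |p| * B := by
      rw [hw, norm_smul, norm_div, norm_neg, Real.norm_ofNat, Real.norm_eq_abs]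
      gcongr
      exact ((fderiv ℝ η₀ x).le_opNorm _).trans ((mul_le_of_le_one_right (norm_nonneg _)
        (norm_single_one_le k)).trans (hB x (subset_closure hx)))
    have hφ : ContDiff ℝ 2 fun y => ψ y • w := hψ.smul contDiff_const
    have hsum : ContDiff ℝ 2 fun y => η₀ y + ψ y • w := hc.add hφ
    have hdist : S.W2qDist η₀ (fun y => η₀ y + ψ y • w) < ε := by
      rw [S.W2qDist_self_add hc hφ]
      calc (∫ y in S.Ω0, sobolevDensity S.q (fun y => ψ y • w) y) ^ (1 / S.q)
          ≤ (‖w‖ ^ S.q * J) ^ (1 / S.q) := by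
            refine Real.rpow_le_rpow (integral_nonneg fun y => sobolevDensity_nonneg _ _ _) ?_
              (by positivity)
            rw [hJ, ← integral_const_mul]
            exact integral_mono
              ((continuous_sobolevDensity hq.le hφ).integrableOn_of_isBounded S.boundedΩ0)
              (((continuous_sobolevDensity hq.le hψ).integrableOn_of_isBounded
                S.boundedΩ0).const_mul _) fun y => sobolevDensity_smul_const_le hq.le hψ w y
        _ = ‖w‖ * J ^ (1 / S.q) := by
            rw [Real.mul_rpow (by positivity) hJ0, one_div,
              Real.rpow_rpow_inv (norm_nonneg _) hq.ne']
        _ ≤ 2 / |p| * B * J ^ (1 / S.q) := by gcongr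
        _ = (2 * B / ε * J ^ (1 / S.q)) * ε / |p| := by field_simp
        _ < |p| * ε / |p| := by gcongr
        _ = ε := by field_simp
    have hmem := hball _ ⟨S.memW2q_of_contDiff hsum, fun y hy => by
      simp [hψP y hy, hE.2.2.2.2 hy]⟩ hdist
    have hnonneg : 0 ≤ Jdet (fun y => η₀ y + ψ y • w) x :=
      closure_minimal (fun y hy => hy.2.le)
        (isClosed_le continuous_const (continuous_Jdet hsum))
        (subset_closure_of_ae_restrict S.isOpenΩ0 hmem.2.1 hx)
    rw [hw, Jdet_add_smul_column hc hψ, ← hp] at hnonneg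
    have : 1 + -2 / p * p = -1 := by
      rw [div_mul_cancel₀ _ (abs_pos.1 hp0)]; norm_num
    rw [this] at hnonneg
    linarith
  have hcl : closure S.Ω0 ⊆ closure {x ∈ S.Ω0 | 0 < Jdet η₀ x} :=
    closure_minimal (subset_closure_of_ae_restrict S.isOpenΩ0 hE.2.1) isClosed_closure
  have hψ1 : Continuous (fderiv ℝ ψ) := hψ.continuous_fderiv (by norm_num)
  have hbound : ‖fderiv ℝ ψ x‖ ≤ 3 * (2 * B / ε) * J ^ (1 / S.q) := by
    refine closure_minimal (t := {x | ‖fderiv ℝ ψ x‖ ≤ 3 * (2 * B / ε) * J ^ (1 / S.q)})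
      (fun y hy => ?_) (isClosed_le hψ1.norm continuous_const) (hcl hx)
    calc ‖fderiv ℝ ψ y‖ ≤ ∑ k, |fderiv ℝ ψ y (Pi.single k 1)| :=
          ContinuousLinearMap.norm_le_sum_abs_apply_single _
      _ ≤ ∑ _k : Fin 3, 2 * B / ε * J ^ (1 / S.q) :=
          Finset.sum_le_sum fun k _ => hgood y hy.1 hy.2 k
      _ = _ := by simp; ring
  calc ‖fderiv ℝ ψ x‖ ^ S.q ≤ (3 * (2 * B / ε) * J ^ (1 / S.q)) ^ S.q := by gcongr
    _ = _ := by
      rw [Real.mul_rpow (by positivity) (by positivity), one_div,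
        Real.rpow_inv_rpow hJ0 hq.ne']

lemma setIntegral_norm_iteratedFDeriv_le_of_eel_le (S : ElasticSetting) {η : ℝ3 → ℝ3}
    (hη : S.memE η) {E : ℝ} (hE : S.eel η ≤ E) :
    ∫ X in S.Ω0, ‖iteratedFDeriv ℝ 2 η X‖ ^ S.q ≤ S.q * E := by
  have hq : 0 < S.q := by linarith [S.hq]
  have hc2 : Continuous (iteratedFDeriv ℝ 2 η) := hη.1.1.continuous_iteratedFDeriv le_rfl
  have hint : IntegrableOn (fun X => ‖iteratedFDeriv ℝ 2 η X‖ ^ S.q) S.Ω0 :=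
    (hc2.norm.rpow_const fun _ => Or.inr hq.le).integrableOn_of_isBounded S.boundedΩ0
  have h : ∫ X in S.Ω0, 1 / S.q * ‖iteratedFDeriv ℝ 2 η X‖ ^ S.q ≤ S.eel η := by
    refine integral_mono_ae (hint.const_mul _) hη.2.2.1 ?_
    filter_upwards [hη.2.1] with X hX
    have h1 := S.hW0 (grad η X)
    have h2 := Real.rpow_nonneg hX.le (-S.a)
    simp only [eelInt]
    linarith
  rw [integral_const_mul] at h
  have h3 := h.trans hE
  rwa [one_div, inv_mul_le_iff₀ hq] at h3

/-- Deformations of bounded elastic energy which are close in `L²` to an interior point of the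
admissible set are uniformly close to it. -/
lemma exists_forall_norm_sub_le_of_memIntE (S : ElasticSetting) {η₀ : ℝ3 → ℝ3}
    (hη₀ : S.memIntE η₀) {E σ : ℝ} (hE : 0 ≤ E) (hη₀E : S.eel η₀ ≤ E) (hσ : 0 < σ) :
    ∃ Γ > 0, ∀ η : ℝ3 → ℝ3, S.memE η → S.eel η ≤ E →
      L2Norm S.Ω0 (fun X => η X - η₀ X) < Γ → ∀ x ∈ closure S.Ω0, ‖η x - η₀ x‖ ≤ σ := by
  have hq : 0 < S.q := by linarith [S.hq]
  obtain ⟨C, hC, hemb⟩ := S.exists_gradient_embedding_of_memIntE hη₀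
  obtain ⟨Γ, hΓ, hsmall⟩ := exists_forall_abs_le_of_gradient_embedding S.isOpenΩ0 S.boundedΩ0
    (by linarith [S.hq]) hC hemb (H := 3 ^ S.q * (S.q * E + S.q * E)) (by positivity) hσ
  refine ⟨√Γ, Real.sqrt_pos.2 hΓ, fun η hη hηE hL x hx => ?_⟩
  have hc₀ : ContDiff ℝ 2 η₀ := hη₀.1.1.1
  have hc : ContDiff ℝ 2 η := hη.1.1
  have hsub : ContDiff ℝ 2 (η - η₀) := hc.sub hc₀
  rw [pi_norm_le_iff_of_nonneg hσ.le]
  intro i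
  have hui : ContDiff ℝ 2 fun y => η y i - η₀ y i := contDiff_pi.1 hsub i
  have hint : ∀ ζ : ℝ3 → ℝ3, ContDiff ℝ 2 ζ →
      IntegrableOn (fun X => ‖iteratedFDeriv ℝ 2 ζ X‖ ^ S.q) S.Ω0 := fun ζ hζ =>
    ((hζ.continuous_iteratedFDeriv le_rfl).norm.rpow_const
      fun _ => Or.inr hq.le).integrableOn_of_isBounded S.boundedΩ0
  refine hsmall (fun y => η y i - η₀ y i) hui (fun y hy => ?_) ?_ ?_ x hx
  · rw [hη.2.2.2.2 hy, hη₀.1.2.2.2.2 hy, sub_self]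
  · calc ∫ y in S.Ω0, ‖iteratedFDeriv ℝ 2 (fun y => η y i - η₀ y i) y‖ ^ S.q
        ≤ ∫ y in S.Ω0, 3 ^ S.q * (‖iteratedFDeriv ℝ 2 η y‖ ^ S.q +
            ‖iteratedFDeriv ℝ 2 η₀ y‖ ^ S.q) := by
          refine integral_mono (((hui.continuous_iteratedFDeriv le_rfl).norm.rpow_const
            fun _ => Or.inr hq.le).integrableOn_of_isBounded S.boundedΩ0)
            (((hint η hc).add (hint η₀ hc₀)).const_mul _) fun y => ?_
          have hproj : ‖(ContinuousLinearMap.proj i : ℝ3 →L[ℝ] ℝ)‖ ≤ 1 :=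
            ContinuousLinearMap.opNorm_le_bound _ zero_le_one fun v => by
              simpa using norm_le_pi_norm v i
          have h1 : ‖iteratedFDeriv ℝ 2 (fun y => η y i - η₀ y i) y‖ ≤
              ‖iteratedFDeriv ℝ 2 η y‖ + ‖iteratedFDeriv ℝ 2 η₀ y‖ + 0 := by
            have h2 := (ContinuousLinearMap.proj i : ℝ3 →L[ℝ] ℝ).norm_iteratedFDeriv_comp_left
              (n := 2) (hsub.contDiffAt (x := y)) (by norm_num)
            rw [iteratedFDeriv_sub_apply hc.contDiffAt hc₀.contDiffAt] at h2
            rw [add_zero]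
            exact h2.trans ((mul_le_of_le_one_left (norm_nonneg _) hproj).trans
              (norm_sub_le _ _))
          have h3 := (Real.rpow_le_rpow (norm_nonneg _) h1 hq.le).trans
            (Real.add_add_rpow_le (norm_nonneg _) (norm_nonneg _) le_rfl hq.le)
          rwa [Real.zero_rpow hq.ne', add_zero] at h3
      _ ≤ 3 ^ S.q * (S.q * E + S.q * E) := by
          rw [integral_const_mul, integral_add (hint η hc) (hint η₀ hc₀)]
          gcongr
          · exact S.setIntegral_norm_iteratedFDeriv_le_of_eel_le hη hηE
          · exact S.setIntegral_norm_iteratedFDeriv_le_of_eel_le hη₀.1 hη₀E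
  · have hcη := hc.continuous
    have hcη₀ := hc₀.continuous
    have hsq : ∫ X in S.Ω0, sq3 (η X - η₀ X) < Γ := by
      have hL' := hL
      rw [L2Norm] at hL'
      exact (Real.sqrt_lt_sqrt_iff (integral_nonneg fun X =>
        Finset.sum_nonneg fun j _ => sq_nonneg _)).1 hL'
    refine le_trans ?_ hsq.le
    refine integral_mono (Continuous.integrableOn_of_isBounded S.boundedΩ0 (by fun_prop))
      (Continuous.integrableOn_of_isBounded S.boundedΩ0 (by unfold sq3; fun_prop)) fun X => ?_
    exact Finset.single_le_sum (f := fun j => (η X - η₀ X) j ^ 2) (fun j _ => sq_nonneg _)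
      (Finset.mem_univ i)

end ElasticSetting

theorem stmt14 (S : ElasticSetting) (E₀ : ℝ) (hE₀ : 0 < E₀)
    -- `δ = δ(E₀)` from the local boundary-injectivity lemma (STATEMENT 13):
    (δ : ℝ) (hδ : 0 < δ)
    (hδprop : ∀ η : ℝ3 → ℝ3, S.memE η → S.eel η ≤ E₀ →
      ∀ X₁ ∈ frontier S.Ω0, ∀ X₂ ∈ frontier S.Ω0,
        X₁ ≠ X₂ → dist X₁ X₂ < δ → η X₁ ≠ η X₂)
    (η₀ : ℝ3 → ℝ3) (hη₀ : S.memIntE η₀) (hη₀E : S.eel η₀ ≤ E₀)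
    (hη₀inj : Set.InjOn η₀ (frontier S.Ω0))
    -- there exist `δ`-separated boundary pairs (so that the minimum below is over
    -- a nonempty set)
    (hpairs : ∃ X₁ ∈ frontier S.Ω0, ∃ X₂ ∈ frontier S.Ω0, δ ≤ dist X₁ X₂) :
    letI ε : ℝ := sInf {d : ℝ | ∃ X₁ ∈ frontier S.Ω0, ∃ X₂ ∈ frontier S.Ω0,
      δ ≤ dist X₁ X₂ ∧ d = ‖η₀ X₁ - η₀ X₂‖}
    0 < ε ∧ ∃ Γ > 0, ∀ η : ℝ3 → ℝ3, S.memE η → S.eel η ≤ E₀ →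
      L2Norm S.Ω0 (fun X => η X - η₀ X) < Γ →
      ∀ X₁ ∈ frontier S.Ω0, ∀ X₂ ∈ frontier S.Ω0,
        δ ≤ dist X₁ X₂ → ε / 2 ≤ ‖η X₁ - η X₂‖ := by
  set ε : ℝ := sInf {d : ℝ | ∃ X₁ ∈ frontier S.Ω0, ∃ X₂ ∈ frontier S.Ω0,
      δ ≤ dist X₁ X₂ ∧ d = ‖η₀ X₁ - η₀ X₂‖} with hεdef
  have hcont : Continuous η₀ := hη₀.1.1.1.continuous
  have hcomp : IsCompact (frontier S.Ω0) :=
    S.boundedΩ0.isCompact_closure.of_isClosed_subset isClosed_frontier frontier_subset_closure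
  have hT : IsCompact {p : ℝ3 × ℝ3 | p ∈ frontier S.Ω0 ×ˢ frontier S.Ω0 ∧ δ ≤ dist p.1 p.2} :=
    (hcomp.prod hcomp).inter_right (isClosed_le continuous_const continuous_dist)
  obtain ⟨Y₁, hY₁, Y₂, hY₂, hY⟩ := hpairs
  obtain ⟨⟨Z₁, Z₂⟩, ⟨⟨hZ₁, hZ₂⟩, hZ⟩, hmin⟩ := hT.exists_isMinOn ⟨(Y₁, Y₂), ⟨hY₁, hY₂⟩, hY⟩
    (f := fun p => ‖η₀ p.1 - η₀ p.2‖) (by fun_prop)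
  have hleast : IsLeast {d : ℝ | ∃ X₁ ∈ frontier S.Ω0, ∃ X₂ ∈ frontier S.Ω0,
      δ ≤ dist X₁ X₂ ∧ d = ‖η₀ X₁ - η₀ X₂‖} ‖η₀ Z₁ - η₀ Z₂‖ := by
    refine ⟨⟨Z₁, hZ₁, Z₂, hZ₂, hZ, rfl⟩, ?_⟩
    rintro d ⟨X₁, h₁, X₂, h₂, hX, rfl⟩
    exact hmin (a := (X₁, X₂)) ⟨⟨h₁, h₂⟩, hX⟩
  have hεeq : ε = ‖η₀ Z₁ - η₀ Z₂‖ := hleast.csInf_eq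
  have hε : 0 < ε := by
    rw [hεeq, norm_pos_iff, sub_ne_zero]
    intro h
    have hZne : Z₁ ≠ Z₂ := dist_pos.1 (hδ.trans_le hZ)
    exact hZne (hη₀inj hZ₁ hZ₂ h)
  obtain ⟨Γ, hΓ, hclose⟩ := S.exists_forall_norm_sub_le_of_memIntE hη₀ hE₀.le hη₀E
    (σ := ε / 4) (by positivity)
  refine ⟨hε, Γ, hΓ, fun η hη hηE hL X₁ h₁ X₂ h₂ hX => ?_⟩
  have c₁ := hclose η hη hηE hL X₁ (frontier_subset_closure h₁)
  have c₂ := hclose η hη hηE hL X₂ (frontier_subset_closure h₂)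
  have hsep : ε ≤ ‖η₀ X₁ - η₀ X₂‖ := hεeq.trans_le (hleast.2 ⟨X₁, h₁, X₂, h₂, hX, rfl⟩)
  have htri : ‖η₀ X₁ - η₀ X₂‖ ≤ ‖η X₁ - η X₂‖ + ‖η X₁ - η₀ X₁‖ + ‖η X₂ - η₀ X₂‖ := by
    have heq : η₀ X₁ - η₀ X₂ = (η X₁ - η X₂) - (η X₁ - η₀ X₁) + (η X₂ - η₀ X₂) := by abel
    rw [heq]
    exact (norm_add_le _ _).trans (add_le_add_left (norm_sub_le _ _) _)
  linarith
end
end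

section
/- Let X be a normed vector space, T > 0 and Δt > 0 with T/Δt ∈ ℕ, and let h^k ∈ X for k = 0, …, T/Δt. Define the piecewise affine interpolant h_{Δt}(t) = (t/Δt − (k−1)) h^k + (k − t/Δt) h^{k−1} and the piecewise constant interpolant h̄_{Δt}(t) = h^k for t ∈ ((k−1)Δt, kΔt]. Suppose there is c > 0 such that ‖h_{Δt}(t₁) − h_{Δt}(t₂)‖_X ≤ c√(t₁ − t₂) for all 0 ≤ t₂ < t₁ ≤ T. Then for all t₁, t₂ ∈ [0,T] with t₁ > t₂ + Δt one has ‖h̄_{Δt}(t₁) − h̄_{Δt}(t₂)‖_X ≤ √2 · c · √(t₁ − t₂). In particular, if t₁ ∈ ((k−1)Δt, kΔt] and t₂ ∈ ((l−1)Δt, lΔt] with k ≥ l+1, then (k − l)Δt ≤ 2(t₁ − t₂). -/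
/-!
STATEMENT 19: Hölder continuity in time transfers from the piecewise affine
interpolant to the piecewise constant interpolant on a uniform time grid.
-/

noncomputable section

/-- The piecewise affine interpolant of the discrete values `h k` on the uniform grid
of step `Δt`:  for `t ∈ ((k−1)Δt, kΔt]` (i.e. `k = ⌈t/Δt⌉`) it equals
`(t/Δt − (k−1)) h k + (k − t/Δt) h (k−1)`. -/
def affineInterp {X : Type*} [AddCommGroup X] [Module ℝ X]
    (Δt : ℝ) (h : ℕ → X) (t : ℝ) : X :=
  (t / Δt - ((⌈t / Δt⌉₊ : ℝ) - 1)) • h ⌈t / Δt⌉₊ +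
    ((⌈t / Δt⌉₊ : ℝ) - t / Δt) • h (⌈t / Δt⌉₊ - 1)

/-- The right-continuous piecewise constant interpolant: `h̄_{Δt}(t) = h k` for
`t ∈ ((k−1)Δt, kΔt]`. -/
def constInterp {X : Type*} (Δt : ℝ) (h : ℕ → X) (t : ℝ) : X :=
  h ⌈t / Δt⌉₊

theorem affineInterp_natCast_mul {X : Type*} [AddCommGroup X] [Module ℝ X]
    {Δt : ℝ} (hΔt : Δt ≠ 0) (h : ℕ → X) (k : ℕ) :
    affineInterp Δt h (k * Δt) = h k := by
  simp [affineInterp, mul_div_cancel_right₀ _ hΔt]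

theorem sub_mul_le_two_mul_sub {Δt t₁ t₂ k l : ℝ} (ht : t₂ + Δt < t₁)
    (h₁ : (k - 1) * Δt < t₁) (h₂ : t₂ ≤ l * Δt) :
    (k - l) * Δt ≤ 2 * (t₁ - t₂) := by
  linarith

theorem stmt19 {X : Type*} [NormedAddCommGroup X] [NormedSpace ℝ X]
    (T Δt : ℝ) (hT : 0 < T) (hΔt : 0 < Δt) (n : ℕ) (hn : T = (n : ℝ) * Δt)
    (h : ℕ → X) (c : ℝ) (hc : 0 < c)
    (hHolder : ∀ t₁ t₂ : ℝ, 0 ≤ t₂ → t₂ < t₁ → t₁ ≤ T →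
      ‖affineInterp Δt h t₁ - affineInterp Δt h t₂‖ ≤ c * Real.sqrt (t₁ - t₂)) :
    (∀ t₁ t₂ : ℝ, t₁ ∈ Set.Icc 0 T → t₂ ∈ Set.Icc 0 T → t₂ + Δt < t₁ →
      ‖constInterp Δt h t₁ - constInterp Δt h t₂‖ ≤ Real.sqrt 2 * c * Real.sqrt (t₁ - t₂)) ∧
    -- In particular: the purely arithmetic estimate `(k−l)Δt ≤ 2(t₁−t₂)`.
    (∀ (t₁ t₂ : ℝ) (k l : ℕ), l + 1 ≤ k → t₂ + Δt < t₁ →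
      t₁ ∈ Set.Ioc (((k : ℝ) - 1) * Δt) ((k : ℝ) * Δt) →
      t₂ ∈ Set.Ioc (((l : ℝ) - 1) * Δt) ((l : ℝ) * Δt) →
      ((k : ℝ) - (l : ℝ)) * Δt ≤ 2 * (t₁ - t₂)) := by
  refine ⟨fun t₁ t₂ ht₁ ht₂ ht => ?_, fun t₁ t₂ k l _ ht hk hl =>
    sub_mul_le_two_mul_sub ht hk.1 hl.2⟩
  have ht₁_pos : 0 < t₁ := by linarith [ht₂.1]
  have hlk : ⌈t₂ / Δt⌉₊ ≤ ⌈t₁ / Δt⌉₊ := by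
    gcongr
    linarith
  have hkn : ⌈t₁ / Δt⌉₊ ≤ n := by
    rw [Nat.ceil_le, div_le_iff₀ hΔt, ← hn]
    exact ht₁.2
  have hk : ((⌈t₁ / Δt⌉₊ : ℝ) - 1) * Δt < t₁ := by
    rw [← lt_div_iff₀ hΔt]
    linarith [Nat.ceil_lt_add_one (div_pos ht₁_pos hΔt).le]
  have hl : t₂ ≤ (⌈t₂ / Δt⌉₊ : ℝ) * Δt := (div_le_iff₀ hΔt).1 (Nat.le_ceil _)
  unfold constInterp
  generalize ⌈t₁ / Δt⌉₊ = k at *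
  generalize ⌈t₂ / Δt⌉₊ = l at *
  rcases hlk.eq_or_lt with rfl | hlk
  · rw [sub_self, norm_zero]
    positivity
  have hgrid := hHolder (k * Δt) (l * Δt) (by positivity) (by gcongr) (by rw [hn]; gcongr)
  rw [affineInterp_natCast_mul hΔt.ne', affineInterp_natCast_mul hΔt.ne', ← sub_mul] at hgrid
  calc ‖h k - h l‖ ≤ c * √((k - l) * Δt) := hgrid
    _ ≤ c * √(2 * (t₁ - t₂)) :=
      mul_le_mul_of_nonneg_left (Real.sqrt_le_sqrt (sub_mul_le_two_mul_sub ht hk hl)) hc.le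
    _ = √2 * c * √(t₁ - t₂) := by
      rw [Real.sqrt_mul zero_le_two]
      ring
end
end
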